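/- Let T be a tree of order t and s ≥ 2 an integer with t > 7(s-2). Then for every nonincreasing graphic sequence π of length n = t + s - 2, either π is potentially T-graphic or the complementary sequence π̄ is potentially K_s-graphic. Combined with the lower bound, r_pot(K_s, T) = t + s - 2. -/

import Mathlib

open SimpleGraph
open scoped Classical

/-- Degree of a vertex. -/
noncomputable def deg {V : Type} (G : SimpleGraph V) (v : V) : ℕ := Nat.card (G.neighborSet v)

/-- Number of vertices of degree exactly 1 (leaves for trees/forests). -/
noncomputable def numLeaves {V : Type} (G : SimpleGraph V) : ℕ := Nat.card {v : V // deg G v = 1}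

/-- Number of connected components containing at least one edge. -/
noncomputable def numEdgeComps {V : Type} (G : SimpleGraph V) : ℕ :=
  Nat.card {c : G.ConnectedComponent // ∃ v w : V, G.Adj v w ∧ G.connectedComponentMk v = c}

/-- Maximum degree. -/
noncomputable def maxDeg {V : Type} (G : SimpleGraph V) : ℕ := sSup (Set.range (deg G))

/-- `G` and `H` pack: a bijection sends edges of `H` to non-edges of `G`. -/
def Packs {V W : Type} (G : SimpleGraph V) (H : SimpleGraph W) : Prop :=
  ∃ f : W ≃ V, ∀ x y : W, H.Adj x y → ¬ G.Adj (f x) (f y)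

/-- `G` contains a copy of `H` as a subgraph. -/
def ContainsCopy {V W : Type} (G : SimpleGraph V) (H : SimpleGraph W) : Prop :=
  ∃ f : W ↪ V, ∀ x y : W, H.Adj x y → G.Adj (f x) (f y)

/-- `G` realizes the degree sequence `π`. -/
def IsRealization {n : ℕ} (G : SimpleGraph (Fin n)) (π : Fin n → ℕ) : Prop :=
  ∀ i, deg G i = π i

/-- `π` is a graphic sequence. -/
def Graphic {n : ℕ} (π : Fin n → ℕ) : Prop :=
  ∃ G : SimpleGraph (Fin n), IsRealization G π

/-- `π` is potentially `H`-graphic. -/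
def PotentiallyGraphic {n : ℕ} {W : Type} (π : Fin n → ℕ) (H : SimpleGraph W) : Prop :=
  ∃ G : SimpleGraph (Fin n), IsRealization G π ∧ ContainsCopy G H

/-- The complementary sequence `π̄ = (n-1-d_n, …, n-1-d_1)`. -/
def compSeq {n : ℕ} (π : Fin n → ℕ) : Fin n → ℕ := fun i => n - 1 - π i.rev

/-- The potential-Ramsey number. -/
noncomputable def rpot {W₁ W₂ : Type} (H₁ : SimpleGraph W₁) (H₂ : SimpleGraph W₂) : ℕ :=
  sInf {N : ℕ | ∀ π : Fin N → ℕ, Antitone π → Graphic π →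
    PotentiallyGraphic π H₁ ∨ PotentiallyGraphic (compSeq π) H₂}

/-- The star `K_{1,t-1}` on `t` vertices, centered at vertex `0`. -/
def starGraph (t : ℕ) : SimpleGraph (Fin t) := SimpleGraph.fromRel (fun i _ => (i : ℕ) = 0)

/-- The neighbours of `v` as a finset. -/
noncomputable def nbrs {V : Type} [Fintype V] (G : SimpleGraph V) (v : V) : Finset V :=
  Finset.univ.filter (G.Adj v)

/-- Two graphs have the same degree at every vertex. -/
def SameDeg {V : Type} [Fintype V] (G H : SimpleGraph V) : Prop :=
  ∀ v, (nbrs G v).card = (nbrs H v).card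

section Exchange

variable {V : Type} [Fintype V]

@[simp] lemma mem_nbrs {G : SimpleGraph V} {v w : V} : w ∈ nbrs G v ↔ G.Adj v w := by
  simp [nbrs]

lemma SameDeg.trans {G H K : SimpleGraph V} (h₁ : SameDeg G H) (h₂ : SameDeg H K) :
    SameDeg G K := fun v => (h₁ v).trans (h₂ v)

/-- Exchanging the roles of `a` and `b` towards the vertices of `E`. -/
def exchange (G : SimpleGraph V) (a b : V) (E : Finset V) : SimpleGraph V where
  Adj u v := G.Adj (if v ∈ E then Equiv.swap a b u else u) (if u ∈ E then Equiv.swap a b v else v)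
  symm := ⟨fun _ _ h => h.symm⟩
  loopless := ⟨fun _ h => G.loopless.irrefl _ h⟩

lemma exists_exchange (G : SimpleGraph V) {a b : V} {E : Finset V} (ha : a ∉ E) (hb : b ∉ E)
    (hE : (nbrs G a ∩ E).card = (nbrs G b ∩ E).card) :
    ∃ H : SimpleGraph V, SameDeg H G ∧ (∀ u ∈ E, H.Adj a u ↔ G.Adj b u) ∧
      (∀ u ∈ E, H.Adj b u ↔ G.Adj a u) ∧
      ∀ u v, ¬ (u ∈ E ∧ (v = a ∨ v = b)) → ¬ (v ∈ E ∧ (u = a ∨ u = b)) →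
        (H.Adj u v ↔ G.Adj u v) := by
  have key : ∀ u v, ¬ (u ∈ E ∧ (v = a ∨ v = b)) → ¬ (v ∈ E ∧ (u = a ∨ u = b)) →
        ((exchange G a b E).Adj u v ↔ G.Adj u v) := by
    intro u v h₁ h₂
    simp only [exchange]
    by_cases hv : v ∈ E <;> by_cases hu : u ∈ E <;> simp only [hu, hv, if_true, if_false]
    · rw [Equiv.swap_apply_of_ne_of_ne, Equiv.swap_apply_of_ne_of_ne] <;> grind
    · rw [Equiv.swap_apply_of_ne_of_ne] <;> grind
    · rw [Equiv.swap_apply_of_ne_of_ne] <;> grind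
  have hA : ∀ u ∈ E, (exchange G a b E).Adj a u ↔ G.Adj b u := by
    intro u hu; simp [exchange, hu, ha]
  have hB : ∀ u ∈ E, (exchange G a b E).Adj b u ↔ G.Adj a u := by
    intro u hu; simp [exchange, hu, hb]
  refine ⟨exchange G a b E, ?_, hA, hB, key⟩
  have split : ∀ K : SimpleGraph V, ∀ v, (nbrs K v).card =
      (nbrs K v ∩ E).card + (nbrs K v \ E).card := fun K v =>
    (Finset.card_inter_add_card_sdiff _ _).symm
  intro v
  by_cases hva : v = a
  · subst hva
    rw [split, split G]
    congr 1
    · rw [hE]; congr 1; ext u; simp only [Finset.mem_inter, mem_nbrs]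
      exact and_congr_left (hA u)
    · congr 1; ext u; simp only [Finset.mem_sdiff, mem_nbrs]
      exact and_congr_left fun hu => key _ _ (by grind) (by grind)
  by_cases hvb : v = b
  · subst hvb
    rw [split, split G]
    congr 1
    · rw [← hE]; congr 1; ext u; simp only [Finset.mem_inter, mem_nbrs]
      exact and_congr_left (hB u)
    · congr 1; ext u; simp only [Finset.mem_sdiff, mem_nbrs]
      exact and_congr_left fun hu => key _ _ (by grind) (by grind)
  by_cases hv : v ∈ E
  · have : nbrs (exchange G a b E) v = (nbrs G v).map (Equiv.swap a b).toEmbedding := by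
      ext u
      rw [Finset.mem_map_equiv]
      simp only [mem_nbrs, exchange, hv, if_true, Equiv.symm_swap,
        Equiv.swap_apply_of_ne_of_ne hva hvb, ite_self]
    rw [this, Finset.card_map]
  · congr 1; ext u; simp only [mem_nbrs]
    exact key _ _ (by grind) (by grind)

lemma exists_twoSwitch (G : SimpleGraph V) {a q b w : V} (haq : G.Adj a q) (hbw : G.Adj b w)
    (haw : ¬ G.Adj a w) (hbq : ¬ G.Adj b q) (haw' : a ≠ w) (hbq' : b ≠ q) :
    ∃ H : SimpleGraph V, SameDeg H G ∧ ∀ u v, H.Adj u v ↔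
      (G.Adj u v ∧ ¬ (u = a ∧ v = q) ∧ ¬ (u = q ∧ v = a) ∧ ¬ (u = b ∧ v = w) ∧
        ¬ (u = w ∧ v = b)) ∨
      (u = a ∧ v = w) ∨ (u = w ∧ v = a) ∨ (u = b ∧ v = q) ∨ (u = q ∧ v = b) := by
  have h1 := haq.ne
  have h2 := hbw.ne
  have h3 : q ≠ w := by rintro rfl; exact haw haq
  have h4 : a ≠ b := by rintro rfl; exact haw hbw
  obtain ⟨H, hH, h5, h6, h7⟩ := exists_exchange G (a := a) (b := b) (E := {q, w})
    (by simp [h1, haw']) (by simp [h2, hbq']) (by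
      have e1 : nbrs G a ∩ {q, w} = {q} := by ext u; simp; grind
      have e2 : nbrs G b ∩ {q, w} = {w} := by ext u; simp; grind
      rw [e1, e2]; rfl)
  refine ⟨H, hH, fun u v => ?_⟩
  have h5q := h5 q (by simp)
  have h5w := h5 w (by simp)
  have h6q := h6 q (by simp)
  have h6w := h6 w (by simp)
  have h7 := h7 u v
  have s1 := H.adj_comm u v
  have s2 := G.adj_comm u v
  simp only [Finset.mem_insert, Finset.mem_singleton] at h7
  by_cases c1 : u = a
  · grind
  by_cases c2 : u = b
  · grind
  by_cases c3 : v = a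
  · grind
  by_cases c4 : v = b
  · grind
  grind

end Exchange

section Tree

variable {W : Type} {T : SimpleGraph W}

/-- A height function of a tree rooted at `r`. -/
lemma SimpleGraph.IsTree.exists_height (hT : T.IsTree) (r : W) :
    ∃ h : W → ℕ, (∀ v, h r ≤ h v) ∧
      (∀ v w, T.Adj v w → h v = h w + 1 ∨ h w = h v + 1) ∧
      ∀ v w w', T.Adj v w → T.Adj v w' → h w ≤ h v → h w' ≤ h v → w = w' := by
  refine ⟨T.dist r, fun v => by simp, fun v w hvw => hT.dist_eq_dist_add_one_of_adj r hvw, ?_⟩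
  have key : ∀ v w, T.Adj v w → T.dist r w ≤ T.dist r v →
      ∃ p : T.Walk r v, p.IsPath ∧ p.penultimate = w := by
    intro v w hvw hle
    obtain ⟨p, hp, hl⟩ := hT.connected.exists_path_of_dist r w
    refine ⟨p.concat hvw.symm, ?_, by simp⟩
    apply Walk.isPath_of_length_eq_dist
    rw [Walk.length_concat, hl]
    rcases hT.dist_eq_dist_add_one_of_adj r hvw with h | h <;> omega
  intro v w w' hw hw' h h'
  obtain ⟨p, hp, rfl⟩ := key v w hw h
  obtain ⟨p', hp', rfl⟩ := key v w' hw' h'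
  have := hT.existsUnique_path r v |>.unique hp hp'
  rw [this]

variable [Fintype W]

lemma card_nbrs_eq_degree (v : W) : (nbrs T v).card = T.degree v := by
  rw [← T.card_neighborFinset_eq_degree]; congr 1; ext; simp

lemma SimpleGraph.IsTree.exists_indep (hT : T.IsTree) {m : ℕ} (hm : 2 * m ≤ Fintype.card W) :
    ∃ I : Finset W, I.card = m ∧ ∀ x ∈ I, ∀ y ∈ I, ¬ T.Adj x y := by
  obtain ⟨r⟩ := hT.connected.nonempty
  obtain ⟨h, -, h2, -⟩ := hT.exists_height r
  set A := Finset.univ.filter fun v => h v % 2 = 0 with hA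
  have hAB : A.card + Aᶜ.card = Fintype.card W := Finset.card_add_card_compl A
  have : ∃ B : Finset W, m ≤ B.card ∧ ∀ x ∈ B, ∀ y ∈ B, h x % 2 = h y % 2 := by
    by_cases hc : m ≤ A.card
    · exact ⟨A, hc, by simp only [hA, Finset.mem_filter]; grind⟩
    · refine ⟨Aᶜ, by omega, ?_⟩
      simp only [hA, Finset.mem_compl, Finset.mem_filter, Finset.mem_univ, true_and]
      grind
  obtain ⟨B, hB, hB'⟩ := this
  obtain ⟨I, hI, hIm⟩ := Finset.exists_subset_card_eq hB
  refine ⟨I, hIm, fun x hx y hy hxy => ?_⟩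
  have := hB' x (hI hx) y (hI hy)
  have := h2 x y hxy
  omega

lemma SimpleGraph.IsTree.sum_card_nbrs (hT : T.IsTree) :
    ∑ v, (nbrs T v).card + 2 = 2 * Fintype.card W := by
  have h1 := hT.card_edgeFinset
  have h2 := T.sum_degrees_eq_twice_card_edges
  simp only [card_nbrs_eq_degree]
  omega

lemma SimpleGraph.IsTree.nbrs_nonempty (hT : T.IsTree) (hW : 2 ≤ Fintype.card W) (v : W) :
    0 < (nbrs T v).card := by
  have : Nontrivial W := Fintype.one_lt_card_iff_nontrivial.1 hW
  rw [card_nbrs_eq_degree]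
  exact hT.connected.preconnected.degree_pos_of_nontrivial v

/-- The leaves of a tree. -/
noncomputable def leaves (T : SimpleGraph W) : Finset W :=
  Finset.univ.filter fun v => (nbrs T v).card = 1

lemma SimpleGraph.IsTree.sum_card_nbrs_le (hT : T.IsTree) (hW : 2 ≤ Fintype.card W)
    (Z : Finset W) : ∑ v ∈ Z, (nbrs T v).card + 2 ≤ 2 * Z.card + (leaves T).card := by
  have h1 := hT.sum_card_nbrs
  have h2 : ∑ v ∈ Z, (nbrs T v).card + ∑ v ∈ Zᶜ, (nbrs T v).card = ∑ v, (nbrs T v).card :=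
    Finset.sum_add_sum_compl Z _
  have h3 : ∑ v ∈ Zᶜ, 2 ≤ ∑ v ∈ Zᶜ, ((nbrs T v).card + if v ∈ leaves T then 1 else 0) := by
    apply Finset.sum_le_sum
    intro v _
    have := hT.nbrs_nonempty hW v
    simp only [leaves, Finset.mem_filter, Finset.mem_univ, true_and]
    split_ifs <;> omega
  have h4 : ∑ v ∈ Zᶜ, (if v ∈ leaves T then 1 else 0) ≤ (leaves T).card := by
    rw [← Finset.sum_filter, ← Finset.card_eq_sum_ones]
    apply Finset.card_le_card
    intro v; simp
  have h5 : Z.card + Zᶜ.card = Fintype.card W := Finset.card_add_card_compl Z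
  rw [Finset.sum_add_distrib] at h3
  simp only [Finset.sum_const, smul_eq_mul] at h3
  omega

end Tree

/-- The complement of `G` contains a copy of `T`. -/
def Avoids {V W : Type} (G : SimpleGraph V) (T : SimpleGraph W) : Prop :=
  ∃ φ : W → V, Function.Injective φ ∧ ∀ a b, T.Adj a b → ¬ G.Adj (φ a) (φ b)

section Greedy

variable {V W : Type} [Fintype V] [Fintype W] {T : SimpleGraph W}

lemma eq_of_mem_leaves {a b c : W} (ha : a ∈ leaves T) (hb : T.Adj a b) (hc : T.Adj a c) :
    b = c := by
  simp only [leaves, Finset.mem_filter, Finset.mem_univ, true_and] at ha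
  exact Finset.card_le_one.1 ha.le b (by simpa) c (by simpa)

lemma SimpleGraph.IsTree.notMem_leaves_of_adj (hT : T.IsTree) (hW : 3 ≤ Fintype.card W)
    {a b : W} (hab : T.Adj a b) (ha : a ∈ leaves T) : b ∉ leaves T := by
  intro hb
  have key : ∀ u v (p : T.Walk u v), u ∈ ({a, b} : Finset W) → v ∈ ({a, b} : Finset W) := by
    intro u v p
    induction p with
    | nil => exact id
    | cons h p ih =>
      intro hu
      apply ih
      rcases Finset.mem_insert.1 hu with rfl | hu
      · simp [eq_of_mem_leaves ha h hab]
      · rw [Finset.mem_singleton] at hu; subst hu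
        simp [eq_of_mem_leaves hb h hab.symm]
  have : Finset.univ ⊆ ({a, b} : Finset W) := fun v _ =>
    (hT.connected.preconnected a v).elim fun p => key a v p (by simp)
  have := Finset.card_le_card this
  have := Finset.card_le_two (a := a) (b := b)
  simp only [Finset.card_univ] at *
  omega

lemma SimpleGraph.IsTree.avoids_of_few_high (hT : T.IsTree) (hW : 3 ≤ Fintype.card W)
    (G : SimpleGraph V) {k : ℕ} (hn : Fintype.card V = Fintype.card W + k)
    (hj : (Finset.univ.filter fun v => k + 1 ≤ (nbrs G v).card).card ≤ (leaves T).card) :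
    Avoids G T := by
  obtain ⟨r⟩ := hT.connected.nonempty
  have hV : Nonempty V := Fintype.card_pos_iff.1 (by omega)
  obtain ⟨h, -, -, h3⟩ := hT.exists_height r
  obtain ⟨B, hB⟩ : ∃ B, ∀ v, h v < B := by
    refine ⟨∑ v, h v + 1, fun v => ?_⟩
    have := Finset.single_le_sum (f := h) (fun _ _ => Nat.zero_le _) (Finset.mem_univ v)
    omega
  let f : W → ℕ := fun v => if v ∈ leaves T then h v + B else h v
  have hf1 : ∀ v w, f v ≤ f w → v ∈ leaves T → w ∈ leaves T := by
    intro v w hvw hv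
    by_contra hw
    simp only [f, hv, hw, if_true, if_false] at hvw
    have := hB w
    omega
  suffices H : ∀ s : Finset W, ∃ φ : W → V, (∀ x ∈ s, ∀ y ∈ s, φ x = φ y → x = y) ∧
      (∀ v ∈ s, v ∉ leaves T → (nbrs G (φ v)).card ≤ k) ∧
      ∀ a ∈ s, ∀ b ∈ s, T.Adj a b → ¬ G.Adj (φ a) (φ b) by
    obtain ⟨φ, h1, -, h2⟩ := H Finset.univ
    exact ⟨φ, fun x y => h1 x (by simp) y (by simp), fun a b => h2 a (by simp) b (by simp)⟩
  intro s
  induction s using Finset.induction_on_max_value f with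
  | empty => exact ⟨fun _ => Classical.arbitrary V, by simp⟩
  | insert a s has hmax ih =>
    obtain ⟨φ, p1, p2, p3⟩ := ih
    set P := s.filter fun b => T.Adj a b with hP
    have hPl : ∀ b ∈ P, b ∉ leaves T := by
      intro b hb hbl
      simp only [hP, Finset.mem_filter] at hb
      exact hT.notMem_leaves_of_adj hW hb.2 (hf1 _ _ (hmax b hb.1) hbl) hbl
    have hPc : P.card ≤ 1 := by
      refine Finset.card_le_one.2 fun b hb c hc => ?_
      have hbl := hPl b hb
      have hcl := hPl c hc
      simp only [hP, Finset.mem_filter] at hb hc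
      by_cases hal : a ∈ leaves T
      · exact eq_of_mem_leaves hal hb.2 hc.2
      · have e1 := hmax b hb.1
        have e2 := hmax c hc.1
        simp only [f, hal, hbl, hcl, if_false] at e1 e2
        exact h3 a b c hb.2 hc.2 e1 e2
    set N := P.biUnion fun b => nbrs G (φ b) with hN
    have hNc : N.card ≤ k := by
      have := Finset.card_biUnion_le_card_mul P (fun b => nbrs G (φ b)) k fun b hb =>
        p2 b (Finset.mem_filter.1 hb).1 (hPl b hb)
      nlinarith
    set Hi := Finset.univ.filter fun v => k + 1 ≤ (nbrs G v).card with hHi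
    set X := if a ∈ leaves T then ∅ else Hi with hX
    have hXc : s.card + X.card < Fintype.card W := by
      have hle : (insert a s).card ≤ Fintype.card W := Finset.card_le_univ _
      rw [Finset.card_insert_of_notMem has] at hle
      by_cases hal : a ∈ leaves T
      · simp [hX, hal]; omega
      · have : insert a s ⊆ (leaves T)ᶜ := by
          intro b hb
          rw [Finset.mem_compl]
          rcases Finset.mem_insert.1 hb with rfl | hb
          · exact hal
          · exact fun hbl => hal (hf1 _ _ (hmax b hb) hbl)
        have := Finset.card_le_card this
        rw [Finset.card_compl, Finset.card_insert_of_notMem has] at this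
        simp only [hX, hal, if_false]
        omega
    obtain ⟨w, hw⟩ : ∃ w, w ∉ s.image φ ∪ N ∪ X := by
      by_contra! hcon
      have e0 : (Finset.univ : Finset V) ⊆ s.image φ ∪ N ∪ X := fun w _ => hcon w
      have e1 := Finset.card_le_card e0
      have e2 := Finset.card_union_le (s.image φ ∪ N) X
      have e3 := Finset.card_union_le (s.image φ) N
      have e4 := Finset.card_image_le (s := s) (f := φ)
      rw [Finset.card_univ] at e1
      omega
    simp only [Finset.mem_union, not_or, Finset.mem_image, not_exists, not_and] at hw
    obtain ⟨⟨hw1, hw2⟩, hw3⟩ := hw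
    have hu : ∀ b ∈ s, Function.update φ a w b = φ b := fun b hb =>
      Function.update_of_ne (by rintro rfl; exact has hb) _ _
    have hwN : ∀ b ∈ s, T.Adj a b → ¬ G.Adj (φ b) w := by
      intro b hb hab hadj
      exact hw2 (Finset.mem_biUnion.2 ⟨b, Finset.mem_filter.2 ⟨hb, hab⟩, by simpa⟩)
    refine ⟨Function.update φ a w, ?_, ?_, ?_⟩
    · simp only [Finset.forall_mem_insert, Function.update_self]
      grind
    · simp only [Finset.forall_mem_insert, Function.update_self]
      refine ⟨fun hal => ?_, fun v hv => by rw [hu v hv]; exact p2 v hv⟩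
      simp only [hX, hal, if_false, hHi, Finset.mem_filter, Finset.mem_univ, true_and] at hw3
      omega
    · simp only [Finset.forall_mem_insert, Function.update_self]
      refine ⟨⟨fun h => (T.irrefl h).elim, fun b hb hab => ?_⟩, fun b hb => ⟨fun hab => ?_,
        fun c hc => ?_⟩⟩
      · rw [hu b hb]; exact fun h => hwN b hb hab h.symm
      · rw [hu b hb]; exact fun h => hwN b hb hab.symm h
      · rw [hu b hb, hu c hc]; exact p3 b hb c hc

end Greedy

section FewLeaves

variable {V W : Type} [Fintype V] [Fintype W] {T : SimpleGraph W}

lemma card_preimage_nbrs_le (G : SimpleGraph V) {φ : W → V} (hφ : Function.Injective φ) (v : V) :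
    (Finset.univ.filter fun z => G.Adj v (φ z)).card ≤ (nbrs G v).card :=
  Finset.card_le_card_of_injOn φ (fun z hz => by simpa using hz) hφ.injOn

/-- A starting placement can be corrected by swaps along the tree order. -/
lemma SimpleGraph.IsTree.avoids_of_placement (hT : T.IsTree) (hW : 2 ≤ Fintype.card W)
    (G : SimpleGraph V) {k : ℕ} (hk : 3 * k + (leaves T).card + 3 < Fintype.card W)
    {x₀ y₀ : W} (hx₀ : x₀ ∈ leaves T) (hxy : T.Adj x₀ y₀) {x l : V} (hxl : ¬ G.Adj x l)
    {φ₀ : W → V} (hφ₀ : Function.Injective φ₀) (hφx : φ₀ x₀ = x) (hφy : φ₀ y₀ = l)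
    (hd : ∀ w, w ≠ x₀ → (nbrs G (φ₀ w)).card ≤ k) : Avoids G T := by
  obtain ⟨h, h1, h2, h3⟩ := hT.exists_height y₀
  suffices H : ∀ s : Finset W, ∃ φ : W → V, Function.Injective φ ∧ φ x₀ = x ∧ φ y₀ = l ∧
      (∀ w, w ≠ x₀ → (nbrs G (φ w)).card ≤ k) ∧
      ∀ a ∈ s, ∀ b ∈ s, T.Adj a b → ¬ G.Adj (φ a) (φ b) by
    obtain ⟨φ, h1, -, -, -, h2⟩ := H Finset.univ
    exact ⟨φ, h1, fun a b => h2 a (by simp) b (by simp)⟩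
  intro s
  induction s using Finset.induction_on_max_value h with
  | empty => exact ⟨φ₀, hφ₀, hφx, hφy, hd, by simp⟩
  | insert a s has hmax ih =>
    obtain ⟨φ, p1, p2, p3, p4, p5⟩ := ih
    by_cases hconf : ∃ p ∈ s, T.Adj a p ∧ G.Adj (φ a) (φ p)
    swap
    · push Not at hconf
      refine ⟨φ, p1, p2, p3, p4, ?_⟩
      simp only [Finset.forall_mem_insert]
      exact ⟨⟨fun h => (T.irrefl h).elim, hconf⟩, fun b hb =>
        ⟨fun hab h => hconf b hb hab.symm h.symm, p5 b hb⟩⟩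
    obtain ⟨p, hps, hap, hG⟩ := hconf
    have hpar : ∀ b ∈ s, T.Adj a b → b = p := fun b hb hab =>
      h3 a b p hab hap (hmax b hb) (hmax p hps)
    have hay : a ≠ y₀ := by
      rintro rfl
      have := h2 _ _ hap
      have := h1 p
      have := hmax p hps
      omega
    have hax : a ≠ x₀ := by
      rintro rfl
      obtain rfl := eq_of_mem_leaves hx₀ hap hxy
      rw [p2, p3] at hG
      exact hxl hG
    have hpx : p ≠ x₀ := by
      rintro rfl
      exact hay (eq_of_mem_leaves hx₀ hap.symm hxy)
    set Z := Finset.univ.filter fun z => G.Adj (φ a) (φ z) with hZ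
    set Y := Finset.univ.filter fun z => G.Adj (φ p) (φ z) with hY
    have hZc : Z.card ≤ k := (card_preimage_nbrs_le G p1 _).trans (p4 a hax)
    have hYc : Y.card ≤ k := (card_preimage_nbrs_le G p1 _).trans (p4 p hpx)
    obtain ⟨w, hw⟩ : ∃ w, w ∉ {x₀, y₀, p} ∪ Y ∪ Z.biUnion (nbrs T) := by
      by_contra! hcon
      have e0 : (Finset.univ : Finset W) ⊆ {x₀, y₀, p} ∪ Y ∪ Z.biUnion (nbrs T) :=
        fun w _ => hcon w
      have e1 := Finset.card_le_card e0
      have e2 := Finset.card_union_le ({x₀, y₀, p} ∪ Y) (Z.biUnion (nbrs T))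
      have e3 := Finset.card_union_le {x₀, y₀, p} Y
      have e4 := Finset.card_le_three (a := x₀) (b := y₀) (c := p)
      have e5 : (Z.biUnion (nbrs T)).card ≤ ∑ z ∈ Z, (nbrs T z).card := Finset.card_biUnion_le
      have e6 := hT.sum_card_nbrs_le hW Z
      rw [Finset.card_univ] at e1
      omega
    simp only [Finset.mem_union, not_or, Finset.mem_insert, Finset.mem_singleton, hY, hZ,
      Finset.mem_filter, Finset.mem_univ, true_and, Finset.mem_biUnion, not_exists, not_and,
      mem_nbrs] at hw
    obtain ⟨⟨⟨hwx, hwy, hwp⟩, hw1⟩, hw2⟩ := hw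
    have hne : ∀ z, z ≠ a → z ≠ w → (φ ∘ Equiv.swap a w) z = φ z := fun z h1 h2 => by
      simp [Equiv.swap_apply_of_ne_of_ne h1 h2]
    have hpa : p ≠ a := hap.ne'
    have hsa : (φ ∘ Equiv.swap a w) a = φ w := by simp
    have hsw : (φ ∘ Equiv.swap a w) w = φ a := by simp
    have hsp : (φ ∘ Equiv.swap a w) p = φ p := hne p hpa (Ne.symm hwp)
    refine ⟨φ ∘ Equiv.swap a w, p1.comp (Equiv.injective _), ?_, ?_, ?_, ?_⟩
    · rw [hne _ hax.symm (Ne.symm hwx), p2]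
    · rw [hne _ hay.symm (Ne.symm hwy), p3]
    · intro u hu
      by_cases hua : u = a
      · rw [hua, hsa]; exact p4 w hwx
      by_cases huw : u = w
      · rw [huw, hsw]; exact p4 a hax
      rw [hne u hua huw]; exact p4 u hu
    · have hws : ∀ c ∈ s, T.Adj w c → c ≠ a → ¬ G.Adj (φ a) ((φ ∘ Equiv.swap a w) c) := by
        intro c hc hwc hca
        rw [hne c hca hwc.ne']
        exact fun h => hw2 c h hwc.symm
      have hne' : ∀ c ∈ s, c ≠ a := fun c hc => by rintro rfl; exact has hc
      have hall : ∀ b ∈ s, ∀ c ∈ s, T.Adj b c →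
          ¬ G.Adj ((φ ∘ Equiv.swap a w) b) ((φ ∘ Equiv.swap a w) c) := by
        intro b hb c hc hbc
        by_cases hbw : b = w
        · rw [hbw, hsw]; exact hws c hc (hbw ▸ hbc) (hne' c hc)
        by_cases hcw : c = w
        · rw [hcw, hsw]; exact fun h => hws b hb (hcw ▸ hbc.symm) (hne' b hb) h.symm
        rw [hne b (hne' b hb) hbw, hne c (hne' c hc) hcw]
        exact p5 b hb c hc hbc
      simp only [Finset.forall_mem_insert]
      refine ⟨⟨fun h => (T.irrefl h).elim, fun b hb hab => ?_⟩, fun b hb => ⟨fun hab => ?_,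
        hall b hb⟩⟩
      · rw [hpar b hb hab, hsp, hsa]; exact fun h => hw1 h.symm
      · rw [hpar b hb hab.symm, hsp, hsa]; exact hw1

lemma SimpleGraph.IsTree.avoids_of_few_leaves (hT : T.IsTree) (hW : 3 ≤ Fintype.card W)
    (G : SimpleGraph V) {k : ℕ} (hk : 4 * k + 3 < Fintype.card W)
    (hn : Fintype.card V = Fintype.card W + k) (hl : (leaves T).card ≤ k)
    (hj : (Finset.univ.filter fun v => k + 1 ≤ (nbrs G v).card).card ≤ k + 1) :
    Avoids G T := by
  set Hi := Finset.univ.filter fun v => k + 1 ≤ (nbrs G v).card with hHi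
  obtain ⟨X, hX, hXc⟩ := Finset.exists_superset_card_eq hj (by omega)
  have hlow : ∀ v, v ∉ X → (nbrs G v).card ≤ k := by
    intro v hv
    by_contra hc
    exact hv (hX (by simp only [hHi, Finset.mem_filter, Finset.mem_univ, true_and]; omega))
  obtain ⟨l, hlX⟩ : ∃ l, l ∉ X := by
    by_contra! hcon
    have := Finset.card_le_card (fun v _ => hcon v : (Finset.univ : Finset V) ⊆ X)
    rw [Finset.card_univ] at this
    omega
  obtain ⟨x, hxX, hxl⟩ : ∃ x ∈ X, ¬ G.Adj x l := by
    by_contra! hcon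
    have := Finset.card_le_card (fun v hv => by simpa using (hcon v hv).symm : X ⊆ nbrs G l)
    have := hlow l hlX
    omega
  have hnt : Nontrivial W := Fintype.one_lt_card_iff_nontrivial.1 (by omega)
  obtain ⟨x₀, hx₀⟩ := hT.exists_vert_degree_one_of_nontrivial
  rw [← card_nbrs_eq_degree] at hx₀
  have hx₀l : x₀ ∈ leaves T := by simpa [leaves] using hx₀
  obtain ⟨y₀, hy₀⟩ := Finset.card_pos.1 (hx₀ ▸ Nat.one_pos)
  rw [mem_nbrs] at hy₀
  let A := {v // v ∉ X.erase x}
  have hA : Fintype.card W = Fintype.card A := by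
    rw [Fintype.card_subtype_compl, Fintype.card_coe, Finset.card_erase_of_mem hxX]
    omega
  let e := Fintype.equivOfCardEq hA
  let x' : A := ⟨x, by simp⟩
  let l' : A := ⟨l, by simp [hlX]⟩
  let e₁ := e.trans (Equiv.swap (e x₀) x')
  let e₂ := e₁.trans (Equiv.swap (e₁ y₀) l')
  have h1 : e₁ x₀ = x' := by simp [e₁]
  have h2 : e₂ y₀ = l' := by simp [e₂]
  have hxl' : x' ≠ l' := fun h => hlX (by
    have : x = l := congrArg Subtype.val h
    exact this ▸ hxX)
  have h3 : e₂ x₀ = x' := by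
    simp only [e₂, Equiv.trans_apply, h1]
    refine Equiv.swap_apply_of_ne_of_ne ?_ hxl'
    rw [← h1]
    exact fun h => hy₀.ne (e₁.injective h)
  refine hT.avoids_of_placement (by omega) G (k := k) (by omega) hx₀l hy₀ hxl
    (φ₀ := fun w => (e₂ w : V)) (Subtype.val_injective.comp e₂.injective) (by simp [h3, x'])
    (by simp [h2, l']) fun w hw => hlow _ fun hwX => ?_
  have := (e₂ w).2
  rw [Finset.mem_erase, not_and] at this
  refine this (fun h => hw ?_) hwX
  apply e₂.injective
  rw [h3]
  exact Subtype.ext h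

end FewLeaves

section Top

variable {V : Type}

/-- `G` has a clique with `n` vertices. -/
def HasClique (G : SimpleGraph V) (n : ℕ) : Prop :=
  ∃ K : Finset V, K.card = n ∧ ∀ u ∈ K, ∀ v ∈ K, u ≠ v → G.Adj u v

lemma HasClique.of_le {G : SimpleGraph V} {n : ℕ} {K : Finset V} (hK : n ≤ K.card)
    (h : ∀ u ∈ K, ∀ v ∈ K, u ≠ v → G.Adj u v) : HasClique G n := by
  obtain ⟨L, hL, hc⟩ := Finset.exists_subset_card_eq hK
  exact ⟨L, hc, fun u hu v hv => h u (hL hu) v (hL hv)⟩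

variable [Fintype V]

/-- Some realization joins `x` to vertices of largest degree. -/
lemma exists_nbrs_top (G : SimpleGraph V) (x : V) :
    ∃ H : SimpleGraph V, SameDeg H G ∧ ∀ y ∈ nbrs H x, ∀ z ∉ nbrs H x, z ≠ x →
      (nbrs G z).card ≤ (nbrs G y).card := by
  obtain ⟨H, hH, hmax⟩ := Set.exists_max_image {H : SimpleGraph V | SameDeg H G}
    (fun H => ∑ y ∈ nbrs H x, (nbrs G y).card) (Set.toFinite _) ⟨G, fun _ => rfl⟩
  refine ⟨H, hH, fun y hy z hz hzx => ?_⟩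
  by_contra! hlt
  obtain ⟨w, hw⟩ : ∃ w, w ∉ insert y ((nbrs H y).erase x) ∧ w ∈ nbrs H z := by
    by_contra! hcon
    have e1 : nbrs H z ⊆ insert y ((nbrs H y).erase x) := fun w hw => by
      by_contra hc; exact hcon w hc hw
    have e2 := Finset.card_le_card e1
    have e3 := Finset.card_insert_le y ((nbrs H y).erase x)
    have hx : x ∈ nbrs H y := by simpa using (mem_nbrs.1 hy).symm
    have e4 := Finset.card_pos.2 ⟨x, hx⟩
    rw [Finset.card_erase_of_mem hx] at e3
    have e5 := hH y
    have e6 := hH z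
    omega
  simp only [mem_nbrs, Finset.mem_insert, Finset.mem_erase, not_or, not_and] at hw hy hz
  have hwx : w ≠ x := by rintro rfl; exact hz hw.2.symm
  have hyz : y ≠ z := by rintro rfl; exact hz hy
  obtain ⟨H', hH', hadj⟩ := exists_twoSwitch H (a := x) (q := y) (b := w) (w := z) hy hw.2.symm hz
    (fun h => hw.1.2 hwx h.symm) (Ne.symm hzx) hw.1.1
  have hN : nbrs H' x = insert z ((nbrs H x).erase y) := by
    ext u
    simp only [mem_nbrs, hadj, Finset.mem_insert, Finset.mem_erase]
    have := hy.ne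
    have := H.irrefl (v := x)
    grind
  have := hmax H' (hH'.trans hH)
  rw [hN, Finset.sum_insert (by simp [hz])] at this
  have e := Finset.add_sum_erase (nbrs H x) (fun y => (nbrs G y).card) (mem_nbrs.2 hy)
  simp only at e this
  omega

/-- Replacing the part of `G` outside `x` by a graph with the same degrees. -/
lemma exists_lift (G : SimpleGraph V) (x : V) (H : SimpleGraph {v // v ≠ x})
    (hH : SameDeg H (G.comap Subtype.val)) :
    ∃ G' : SimpleGraph V, SameDeg G' G ∧ nbrs G' x = nbrs G x ∧
      ∀ u v : {v // v ≠ x}, G'.Adj u v ↔ H.Adj u v := by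
  let G' : SimpleGraph V :=
    { Adj := fun u v => if h : u ≠ x ∧ v ≠ x then H.Adj ⟨u, h.1⟩ ⟨v, h.2⟩ else G.Adj u v
      symm := ⟨fun u v h => by
        by_cases hu : u = x <;> by_cases hv : v = x <;>
          simp only [hu, hv, ne_eq, not_true_eq_false, and_false, not_false_eq_true,
            and_true, dite_true, dite_false] at h ⊢ <;> exact h.symm⟩
      loopless := ⟨fun u h => by
        by_cases hu : u = x <;> simp [hu] at h⟩ }
  have hx : nbrs G' x = nbrs G x := by ext u; simp [G']
  refine ⟨G', fun v => ?_, hx, fun u v => ?_⟩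
  · by_cases hv : v = x
    · rw [hv, hx]
    have key : ∀ (L : SimpleGraph V) (J : SimpleGraph {v // v ≠ x}),
        (∀ u w, J.Adj u w ↔ L.Adj u w) →
        (nbrs L v).card = (nbrs J ⟨v, hv⟩).card + if L.Adj v x then 1 else 0 := by
      intro L J hLJ
      have e1 : (nbrs J ⟨v, hv⟩).map (Function.Embedding.subtype _) = (nbrs L v).erase x := by
        ext u
        simp only [Finset.mem_map, mem_nbrs, hLJ, Function.Embedding.coe_subtype,
          Subtype.exists, exists_and_right, exists_eq_right, Finset.mem_erase]
        constructor
        · rintro ⟨h1, h2⟩; exact ⟨h1, h2⟩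
        · rintro ⟨h1, h2⟩; exact ⟨h1, h2⟩
      rw [← Finset.card_map (Function.Embedding.subtype _), e1]
      split_ifs with h
      · rw [Finset.card_erase_add_one]; simpa
      · rw [Finset.erase_eq_of_notMem]; · rfl
        simpa
    rw [key G' H (fun u w => by simp [G', u.2, w.2]), key G (G.comap Subtype.val)
      (fun u w => Iff.rfl), hH]
    congr 1
    simp [G']
  · simp [G', u.2, v.2]

end Top

section Extremal

variable {V W : Type} [Fintype V] [Fintype W] {T : SimpleGraph W}

/-- If every edge leaving `Zᶜ` ends in a `k`-subset of `Z`, then `T` avoids `G`. -/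
lemma SimpleGraph.IsTree.avoids_of_indep (hT : T.IsTree) (G : SimpleGraph V) {k : ℕ}
    (hn : Fintype.card V = Fintype.card W + k) {Z D : Finset V} (hDZ : D ⊆ Z) (hD : D.card = k)
    (hZ : 2 * Z.card ≤ Fintype.card W + 2 * k)
    (hG : ∀ g ∉ Z, ∀ h, G.Adj g h → h ∈ D) : Avoids G T := by
  have hkZ : k ≤ Z.card := hD ▸ Finset.card_le_card hDZ
  obtain ⟨I, hI, hI'⟩ := hT.exists_indep (m := Z.card - k) (by omega)
  have hZV : Z.card ≤ Fintype.card V := Finset.card_le_univ Z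
  have c1 : Fintype.card {w // w ∈ I} = Fintype.card {v // v ∈ Z \ D} := by
    rw [Fintype.card_coe, Fintype.card_coe, Finset.card_sdiff_of_subset hDZ, hI, hD]
  have c2 : Fintype.card {w // w ∉ I} = Fintype.card {v // v ∉ Z} := by
    rw [Fintype.card_subtype_compl, Fintype.card_subtype_compl, Fintype.card_coe,
      Fintype.card_coe, hI]
    omega
  let e₁ := Fintype.equivOfCardEq c1
  let e₂ := Fintype.equivOfCardEq c2
  let φ : W → V := fun w => if h : w ∈ I then e₁ ⟨w, h⟩ else e₂ ⟨w, h⟩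
  have h1 : ∀ w (h : w ∈ I), φ w = e₁ ⟨w, h⟩ := fun w h => by simp [φ, h]
  have h2 : ∀ w (h : w ∉ I), φ w = e₂ ⟨w, h⟩ := fun w h => by simp [φ, h]
  have m1 : ∀ w, w ∈ I → φ w ∈ Z \ D := fun w h => h1 w h ▸ (e₁ ⟨w, h⟩).2
  have m2 : ∀ w, w ∉ I → φ w ∉ Z := fun w h => h2 w h ▸ (e₂ ⟨w, h⟩).2
  have hD : ∀ w, φ w ∉ D := by
    intro w hw
    by_cases h : w ∈ I
    · exact (Finset.mem_sdiff.1 (m1 w h)).2 hw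
    · exact m2 w h (hDZ hw)
  refine ⟨φ, fun a b hab => ?_, fun a b hab hadj => ?_⟩
  · by_cases ha : a ∈ I <;> by_cases hb : b ∈ I
    · rw [h1 a ha, h1 b hb] at hab
      simpa using e₁.injective (Subtype.ext hab)
    · exact (m2 b hb (hab ▸ (Finset.mem_sdiff.1 (m1 a ha)).1)).elim
    · exact (m2 a ha (hab ▸ (Finset.mem_sdiff.1 (m1 b hb)).1)).elim
    · rw [h2 a ha, h2 b hb] at hab
      simpa using e₂.injective (Subtype.ext hab)
  · by_cases ha : a ∈ I
    · by_cases hb : b ∈ I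
      · exact hI' a ha b hb hab
      · exact hD a (hG _ (m2 b hb) _ hadj.symm)
    · exact hD b (hG _ (m2 a ha) _ hadj)

/-- A realization in which `x` has neighbourhood `N` and `K` is a clique. -/
structure Good (G₀ : SimpleGraph V) (x : V) (N K : Finset V) (G : SimpleGraph V) : Prop where
  same : SameDeg G G₀
  nbrs_eq : nbrs G x = N
  clique : ∀ u ∈ K, ∀ v ∈ K, u ≠ v → G.Adj u v

/-- `N` consists of vertices of largest degree. -/
def TopSet (G₀ : SimpleGraph V) (x : V) (N : Finset V) : Prop :=
  ∀ y ∈ N, ∀ z ∉ N, z ≠ x → (nbrs G₀ z).card ≤ (nbrs G₀ y).card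

/-- The pair `(N, K)` maximizes `|K ∩ N|`. -/
structure Extremal (G₀ : SimpleGraph V) (x : V) (k : ℕ) (N K : Finset V) : Prop where
  notMem_nbrs : x ∉ N
  notMem : x ∉ K
  card_eq : K.card = k + 1
  top : TopSet G₀ x N
  max : ∀ N' K' : Finset V, x ∉ K' → K'.card = k + 1 → TopSet G₀ x N' →
    (∃ G', Good G₀ x N' K' G') → (K' ∩ N').card ≤ (K ∩ N).card

variable {G₀ G : SimpleGraph V} {x : V} {k : ℕ} {N K : Finset V}

lemma Good.adj_iff (g : Good G₀ x N K G) {v : V} : G.Adj x v ↔ v ∈ N := by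
  rw [← g.nbrs_eq, mem_nbrs]

lemma Extremal.degree_eq (E : Extremal G₀ x k N K) (g : Good G₀ x N K G) {c p : V}
    (hc : c ∈ N) (hcK : c ∉ K) (hp : p ∈ K) (hpN : p ∉ N) :
    (nbrs G₀ c).card = (nbrs G₀ p).card := by
  have hpx : p ≠ x := by rintro rfl; exact E.notMem hp
  have hcx : c ≠ x := by rintro rfl; exact E.notMem_nbrs hc
  have hxc := g.adj_iff.2 hc
  have hxp : ¬ G.Adj x p := fun h => hpN (g.adj_iff.1 h)
  have hcp : c ≠ p := by rintro rfl; exact hcK hp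
  refine le_antisymm ?_ (E.top c hc p hpN hpx)
  by_contra! hlt
  rw [← g.same, ← g.same] at hlt
  set Q := (K.erase p) \ nbrs G c with hQ
  set R := ((nbrs G c \ nbrs G p).erase x).erase p with hR
  have hQR : Q.card ≤ R.card := by
    have e1 := Finset.card_sdiff_add_card_inter (nbrs G c) (nbrs G p)
    have e2 := Finset.card_sdiff_add_card_inter (nbrs G p) (nbrs G c)
    rw [Finset.inter_comm] at e2
    have hx : x ∈ nbrs G c \ nbrs G p := by
      simp only [Finset.mem_sdiff, mem_nbrs]; exact ⟨hxc.symm, fun h => hxp h.symm⟩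
    have e3 := Finset.card_erase_add_one hx
    have hQs : Q ⊆ nbrs G p \ nbrs G c := by
      intro u hu
      simp only [hQ, Finset.mem_sdiff, Finset.mem_erase, mem_nbrs] at hu ⊢
      exact ⟨g.clique p hp u hu.1.2 hu.1.1.symm, hu.2⟩
    by_cases hadj : G.Adj p c
    · have : insert c Q ⊆ nbrs G p \ nbrs G c := by
        refine Finset.insert_subset ?_ hQs
        simpa using hadj
      have e4 := Finset.card_le_card this
      rw [Finset.card_insert_of_notMem (by simp [hQ, hcK])] at e4
      have e5 := Finset.card_erase_add_one (s := (nbrs G c \ nbrs G p).erase x) (a := p)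
        (by simp [hpx, hadj.symm])
      rw [← hR] at e5
      omega
    · have e4 := Finset.card_le_card hQs
      rw [hR, Finset.erase_eq_of_notMem]
      · omega
      · simp only [Finset.mem_erase, Finset.mem_sdiff, mem_nbrs, not_and]
        exact fun _ h => (hadj h.symm).elim
  obtain ⟨Q', hQ', hQc⟩ := Finset.exists_subset_card_eq hQR
  have hQm : ∀ u ∈ Q, u ≠ p ∧ u ∈ K ∧ ¬ G.Adj c u := by
    intro u hu
    simpa [hQ, and_assoc] using hu
  have hQm' : ∀ u ∈ Q', u ≠ p ∧ u ≠ x ∧ G.Adj c u ∧ ¬ G.Adj p u := by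
    intro u hu
    simpa [hR] using hQ' hu
  have hcE : c ∉ Q ∪ Q' := by
    intro h
    rcases Finset.mem_union.1 h with h | h
    · exact hcK (hQm c h).2.1
    · exact G.irrefl (hQm' c h).2.2.1
  have hpE : p ∉ Q ∪ Q' := by
    intro h
    rcases Finset.mem_union.1 h with h | h
    · exact (hQm p h).1 rfl
    · exact (hQm' p h).1 rfl
  have hxE : x ∉ Q ∪ Q' := by
    intro h
    rcases Finset.mem_union.1 h with h | h
    · exact E.notMem (hQm x h).2.1
    · exact (hQm' x h).2.1 rfl
  have hpK : ∀ u ∈ K, u ≠ p → G.Adj p u := fun u hu h => g.clique p hp u hu h.symm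
  obtain ⟨H, hH, h1, h2, h3⟩ := exists_exchange G hcE hpE (by
    have e1 : nbrs G c ∩ (Q ∪ Q') = Q' := by
      ext u
      simp only [Finset.mem_inter, Finset.mem_union, mem_nbrs]
      exact ⟨fun h => h.2.resolve_left fun hq => (hQm u hq).2.2 h.1,
        fun h => ⟨(hQm' u h).2.2.1, Or.inr h⟩⟩
    have e2 : nbrs G p ∩ (Q ∪ Q') = Q := by
      ext u
      simp only [Finset.mem_inter, Finset.mem_union, mem_nbrs]
      exact ⟨fun h => h.2.resolve_right fun hq => (hQm' u hq).2.2.2 h.1,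
        fun h => ⟨hpK u (hQm u h).2.1 (hQm u h).1, Or.inl h⟩⟩
    rw [e1, e2, hQc])
  have hcK' : ∀ u ∈ K, u ≠ p → H.Adj c u := by
    intro u hu hup
    by_cases huE : u ∈ Q ∪ Q'
    · exact (h1 u huE).2 (hpK u hu hup)
    · rw [h3 c u (fun h => hcE h.1) (fun h => huE h.1)]
      by_contra hcu
      exact huE (Finset.mem_union_left _ (by simp [hQ, hup, hu, hcu]))
  have hmax := E.max N (insert c (K.erase p)) (by simp [E.notMem, hcx.symm])
    (by rw [Finset.card_insert_of_notMem (by simp [hcK]), Finset.card_erase_add_one hp, E.card_eq])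
    E.top ⟨H, hH.trans g.same, by
      ext u
      rw [mem_nbrs, h3 x u (fun h => hxE h.1) (fun h => h.2.elim hcx.symm hpx.symm),
        g.adj_iff], by
      intro u hu v hv huv
      simp only [Finset.mem_insert, Finset.mem_erase] at hu hv
      rcases hu with rfl | hu
      · rcases hv with rfl | hv
        · exact (huv rfl).elim
        · exact hcK' v hv.2 hv.1
      · rcases hv with rfl | hv
        · exact (hcK' u hu.2 hu.1).symm
        · rw [h3 u v]
          · exact g.clique u hu.2 v hv.2 huv
          · rintro ⟨-, rfl | rfl⟩
            exacts [hcK hv.2, hv.1 rfl]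
          · rintro ⟨-, rfl | rfl⟩
            exacts [hcK hu.2, hu.1 rfl]⟩
  have : insert c (K.erase p) ∩ N = insert c (K ∩ N) := by
    ext u
    simp only [Finset.mem_inter, Finset.mem_insert, Finset.mem_erase]
    grind
  rw [this, Finset.card_insert_of_notMem (by simp [hcK])] at hmax
  omega

lemma Extremal.adj_of_adj (E : Extremal G₀ x k N K) (g : Good G₀ x N K G) {c p e : V}
    (hc : c ∈ N) (hcK : c ∉ K) (hp : p ∈ K) (hpN : p ∉ N) (hpe : G.Adj p e) (heK : e ∉ K)
    (hec : e ≠ c) : G.Adj c e := by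
  by_contra hce
  have hpx : p ≠ x := by rintro rfl; exact E.notMem hp
  have hcx : c ≠ x := by rintro rfl; exact E.notMem_nbrs hc
  have hxc := g.adj_iff.2 hc
  have hxp : ¬ G.Adj x p := fun h => hpN (g.adj_iff.1 h)
  have hdeg := E.degree_eq g hc hcK hp hpN
  have hcp : c ≠ p := by rintro rfl; exact hcK hp
  have hex : e ≠ x := by rintro rfl; exact hxp hpe.symm
  have hxK := E.notMem
  have hxN := E.notMem_nbrs
  obtain ⟨H, hH, hadj⟩ := exists_twoSwitch G (a := x) (q := c) (b := e) (w := p) hxc hpe.symm hxp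
    (fun h => hce h.symm) hpx.symm hec
  have hmax := E.max (insert p (N.erase c)) K E.notMem E.card_eq (by
      have top := E.top
      intro y hy z hz hzx
      have t1 := top y
      have t2 := top c hc z
      have t3 : y ∈ N → _ := fun hy => top y hy p hpN hpx
      simp only [Finset.mem_insert, Finset.mem_erase, not_or, not_and] at hy hz
      by_cases hzc : z = c
      · subst hzc
        rcases hy with rfl | hy
        · omega
        · have := t3 hy.2; omega
      · have hzN := hz.2 hzc
        rcases hy with rfl | hy
        · have := t2 hzN hzx; omega
        · exact t1 hy.2 z hzN hzx) ⟨H, hH.trans g.same, by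
      ext u
      simp only [mem_nbrs, hadj, g.adj_iff, Finset.mem_insert, Finset.mem_erase]
      grind, by
      intro u hu v hv huv
      rw [hadj]
      have := g.clique u hu v hv huv
      grind⟩
  have : K ∩ insert p (N.erase c) = insert p (K ∩ N) := by
    ext u
    simp only [Finset.mem_inter, Finset.mem_insert, Finset.mem_erase]
    grind
  rw [this, Finset.card_insert_of_notMem (by simp [hpN])] at hmax
  omega

lemma Extremal.mem_of_adj (E : Extremal G₀ x k N K) (g : Good G₀ x N K G) {c p e y z : V}
    (hc : c ∈ N) (hcK : c ∉ K) (hp : p ∈ K) (hpN : p ∉ N) (hpe : G.Adj p e) (heK : e ∉ K)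
    (hyz : G.Adj y z) (hyc : y ≠ c) (hcy : ¬ G.Adj c y) (hyK : y ∉ K) (hyx : y ≠ x)
    (hzx : z ≠ x) : z = e ∨ G.Adj e z := by
  by_contra! hcon
  obtain ⟨hze, hez⟩ := hcon
  have hpx : p ≠ x := by rintro rfl; exact E.notMem hp
  have hxp : ¬ G.Adj x p := fun h => hpN (g.adj_iff.1 h)
  have hex : e ≠ x := by rintro rfl; exact hxp hpe.symm
  have hpy : ¬ G.Adj p y := fun h => hcy (E.adj_of_adj g hc hcK hp hpN h hyK hyc)
  have hye : y ≠ e := by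
    rintro rfl
    exact hpy hpe
  have hcp : c ≠ p := by rintro rfl; exact hcK hp
  have hpy' : p ≠ y := by rintro rfl; exact hyK hp
  obtain ⟨H, hH, hadj⟩ := exists_twoSwitch G (a := p) (q := e) (b := z) (w := y) hpe hyz.symm hpy
    (fun h => hez h.symm) hpy' hze
  have g' : Good G₀ x N K H := ⟨hH.trans g.same, by
    ext u
    simp only [mem_nbrs, hadj, g.adj_iff]
    grind, by
    intro u hu v hv huv
    rw [hadj]
    have := g.clique u hu v hv huv
    grind⟩
  have := E.adj_of_adj g' hc hcK hp hpN (e := y) (by rw [hadj]; grind) hyK hyc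
  rw [hadj] at this
  have := hyz.ne
  grind

lemma Extremal.adj_of_mem (E : Extremal G₀ x k N K) (g : Good G₀ x N K G) {c p e y : V}
    (hc : c ∈ N) (hcK : c ∉ K) (hp : p ∈ K) (hpN : p ∉ N) (hpe : G.Adj p e) (heK : e ∉ K)
    (hy : y ∈ N) (hyK : y ∉ K) (hcy : c ≠ y) : G.Adj c y := by
  by_contra hadj
  have hyc : ¬ G.Adj y c := fun h => hadj h.symm
  have hpx : p ≠ x := by rintro rfl; exact E.notMem hp
  have hxp : ¬ G.Adj x p := fun h => hpN (g.adj_iff.1 h)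
  have hex : e ≠ x := by rintro rfl; exact hxp hpe.symm
  have hec : e ≠ c := by
    rintro rfl
    exact hyc (E.adj_of_adj g hy hyK hp hpN hpe heK hcy)
  have hey : e ≠ y := by
    rintro rfl
    exact hadj (E.adj_of_adj g hc hcK hp hpN hpe heK hcy.symm)
  have hce := E.adj_of_adj g hc hcK hp hpN hpe heK hec
  have hye := E.adj_of_adj g hy hyK hp hpN hpe heK hey
  have hpy : ¬ G.Adj p y := fun h => hadj (E.adj_of_adj g hc hcK hp hpN h hyK hcy.symm)
  have hyx : y ≠ x := by rintro rfl; exact E.notMem_nbrs hy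
  have hxy := g.adj_iff.2 hy
  have hyp : y ≠ p := by rintro rfl; exact hyK hp
  have hcp : c ≠ p := by rintro rfl; exact hcK hp
  have hsub : insert y (insert p (insert c (((nbrs G y).erase x).erase e))) ⊆ nbrs G e := by
    intro z hz
    simp only [Finset.mem_insert, Finset.mem_erase, mem_nbrs] at hz
    rw [mem_nbrs]
    rcases hz with rfl | rfl | rfl | ⟨h1, h2, h3⟩
    · exact hye.symm
    · exact hpe.symm
    · exact hce.symm
    · exact (E.mem_of_adj g hc hcK hp hpN hpe heK h3 hcy.symm hadj hyK hyx h2).resolve_left h1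
  have hcard := Finset.card_le_card hsub
  rw [Finset.card_insert_of_notMem (by simp [hyp, hcy.symm]),
    Finset.card_insert_of_notMem (by
      simp only [Finset.mem_insert, Finset.mem_erase, mem_nbrs]
      exact fun h => h.elim (fun h => hcp h.symm) fun h => hpy h.2.2.symm),
    Finset.card_insert_of_notMem (by
      simp only [Finset.mem_erase, mem_nbrs]
      exact fun h => hyc h.2.2)] at hcard
  have e1 := Finset.card_erase_add_one (s := nbrs G y) (a := x) (by simpa using hxy.symm)
  have e2 := Finset.card_erase_add_one (s := (nbrs G y).erase x) (a := e) (by simp [hex, hye])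
  have e3 : (nbrs G e).card ≤ (nbrs G y).card := by
    rw [g.same, g.same]
    by_cases heN : e ∈ N
    · rw [E.degree_eq g heN heK hp hpN, E.degree_eq g hy hyK hp hpN]
    · exact E.top y hy e heN hex
  omega

end Extremal

section Core

variable {V W : Type} [Fintype V] [Fintype W] {T : SimpleGraph W}
variable {G₀ G : SimpleGraph V} {x : V} {k : ℕ} {N K : Finset V}

/-- The vertices close to the clique `K` or to one of `x`, `c`, `e`. -/
noncomputable def centre (G : SimpleGraph V) (x : V) (K : Finset V) (c e : V) : Finset V :=
  insert x K ∪ (insert c (nbrs G c) ∪ insert e (nbrs G e))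

lemma notMem_centre {c e v : V} : v ∉ centre G x K c e ↔
    (v ≠ x ∧ v ∉ K) ∧ (v ≠ c ∧ ¬ G.Adj c v) ∧ v ≠ e ∧ ¬ G.Adj e v := by
  simp [centre]
  tauto

lemma Extremal.outer (E : Extremal G₀ x k N K) (g : Good G₀ x N K G) {c p e v : V}
    (hc : c ∈ N) (hcK : c ∉ K) (hp : p ∈ K) (hpN : p ∉ N) (hpe : G.Adj p e) (heK : e ∉ K)
    (hv : v ∉ centre G x K c e) :
    ¬ G.Adj x v ∧ ¬ G.Adj p v ∧ ∀ h, G.Adj v h → G.Adj e h := by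
  rw [notMem_centre] at hv
  obtain ⟨⟨hvx, hvK⟩, ⟨hvc, hcv⟩, hve, hev⟩ := hv
  have hxv : ¬ G.Adj x v := fun h =>
    hcv (E.adj_of_mem g hc hcK hp hpN hpe heK (g.adj_iff.1 h) hvK hvc.symm)
  refine ⟨hxv, fun h => hcv (E.adj_of_adj g hc hcK hp hpN h hvK hvc), fun h hvh => ?_⟩
  refine (E.mem_of_adj g hc hcK hp hpN hpe heK hvh hvc hcv hvK hvx ?_).resolve_left ?_
  · rintro rfl; exact hxv hvh.symm
  · rintro rfl; exact hev hvh.symm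

lemma Extremal.adj_of_outer_ne (E : Extremal G₀ x k N K) (g : Good G₀ x N K G)
    {c p e v v' h h' : V}
    (hc : c ∈ N) (hcK : c ∉ K) (hp : p ∈ K) (hpN : p ∉ N) (hpe : G.Adj p e) (heK : e ∉ K)
    (hv : v ∉ centre G x K c e) (hv' : v' ∉ centre G x K c e) (hvv' : v ≠ v')
    (hvh : G.Adj v h) (hvh' : G.Adj v' h') (hh : h ≠ h') : G.Adj h h' := by
  by_contra hadj
  obtain ⟨o1, o2, o3⟩ := E.outer g hc hcK hp hpN hpe heK hv
  obtain ⟨o1', o2', o3'⟩ := E.outer g hc hcK hp hpN hpe heK hv'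
  rw [notMem_centre] at hv hv'
  obtain ⟨⟨hvx, hvK⟩, ⟨hvc, hcv⟩, hve, hev⟩ := hv
  obtain ⟨⟨hvx', hvK'⟩, ⟨hvc', hcv'⟩, hve', hev'⟩ := hv'
  have hnv : ¬ G.Adj v v' := fun hcon => hev' (o3 _ hcon)
  have hhx : h ≠ x := by rintro rfl; exact o1 hvh.symm
  have hhx' : h' ≠ x := by rintro rfl; exact o1' hvh'.symm
  have i1 := hvh.ne
  have i2 := hvh'.ne
  have i3 : v ≠ h' := by rintro rfl; exact hnv hvh'.symm
  have i4 : v' ≠ h := by rintro rfl; exact hnv hvh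
  obtain ⟨H, hH, hHadj⟩ := exists_twoSwitch G (a := v) (q := h) (b := h') (w := v') hvh hvh'.symm
    hnv (fun hcon => hadj hcon.symm) hvv' hh.symm
  have g' : Good G₀ x N K H := ⟨hH.trans g.same, by
    ext u
    simp only [mem_nbrs, hHadj, g.adj_iff]
    grind, by
    intro u hu w hw huw
    rw [hHadj]
    have := g.clique u hu w hw huw
    grind⟩
  have hpv : p ≠ v := by rintro rfl; exact hvK hp
  have hpv' : p ≠ v' := by rintro rfl; exact hvK' hp
  have := E.mem_of_adj g' hc hcK hp hpN (e := e) (y := v) (z := v') (by rw [hHadj]; grind) heK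
    (by rw [hHadj]; grind) hvc (by rw [hHadj]; grind) hvK hvx hvx'
  rw [hHadj] at this
  grind

lemma Extremal.adj_of_outer (E : Extremal G₀ x k N K) (g : Good G₀ x N K G)
    {c p e v h h' : V}
    (hc : c ∈ N) (hcK : c ∉ K) (hp : p ∈ K) (hpN : p ∉ N) (hpe : G.Adj p e) (heK : e ∉ K)
    (hce : c ≠ e) (hv : v ∉ centre G x K c e) (hvh : G.Adj v h) (hvh' : G.Adj v h')
    (hh : h ≠ h') (hhK : h' ∉ K) : G.Adj h h' := by
  by_contra hadj
  obtain ⟨o1, o2, o3⟩ := E.outer g hc hcK hp hpN hpe heK hv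
  rw [notMem_centre] at hv
  obtain ⟨⟨hvx, hvK⟩, ⟨hvc, hcv⟩, hve, hev⟩ := hv
  have hhx : h ≠ x := by rintro rfl; exact o1 hvh.symm
  have hhx' : h' ≠ x := by rintro rfl; exact o1 hvh'.symm
  have hhp : h ≠ p := by rintro rfl; exact o2 hvh.symm
  have hhp' : h' ≠ p := by rintro rfl; exact o2 hvh'.symm
  have hpx : p ≠ x := by rintro rfl; exact E.notMem hp
  have hxp : ¬ G.Adj x p := fun h => hpN (g.adj_iff.1 h)
  have hex : e ≠ x := by rintro rfl; exact hxp hpe.symm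
  have hpv : p ≠ v := by rintro rfl; exact hvK hp
  by_cases hph : G.Adj p h'
  · rcases E.mem_of_adj g hc hcK hp hpN hph hhK hvh hvc hcv hvK hvx hhx with h1 | h1
    · exact hh h1
    · exact hadj h1.symm
  have i1 := hvh.ne
  have i2 := hvh'.ne
  have i3 := (o3 h' hvh').ne
  obtain ⟨H, hH, hHadj⟩ := exists_twoSwitch G (a := p) (q := e) (b := v) (w := h') hpe hvh'
    hph (fun hcon => hev hcon.symm) hhp'.symm hve
  have g' : Good G₀ x N K H := ⟨hH.trans g.same, by
    ext u
    simp only [mem_nbrs, hHadj, g.adj_iff]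
    grind, by
    intro u hu w hw huw
    rw [hHadj]
    have := g.clique u hu w hw huw
    grind⟩
  have := E.mem_of_adj g' hc hcK hp hpN (e := h') (y := v) (z := h) (by rw [hHadj]; grind) hhK
    (by rw [hHadj]; grind) hvc (by rw [hHadj]; grind) hvK hvx hhx
  rw [hHadj] at this
  have := G.adj_comm h h'
  grind

lemma Extremal.avoids (hT : T.IsTree) (hk : 7 * k < Fintype.card W)
    (hn : Fintype.card V = Fintype.card W + k) (E : Extremal G₀ x k N K) (g : Good G₀ x N K G)
    (hD : k + 1 ≤ N.card) (hmax : ∀ v, (nbrs G₀ v).card ≤ N.card)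
    (hj : k + 2 ≤ (Finset.univ.filter fun v => k + 1 ≤ (nbrs G₀ v).card).card)
    (hno : ¬ HasClique G (k + 2)) : Avoids G T := by
  obtain ⟨p, hp, hpN⟩ : ∃ p ∈ K, p ∉ N := by
    by_contra! hcon
    refine hno (HasClique.of_le (K := insert x K) ?_ ?_)
    · rw [Finset.card_insert_of_notMem E.notMem, E.card_eq]
    · intro u hu v hv huv
      rcases Finset.mem_insert.1 hu with rfl | hu' <;>
        rcases Finset.mem_insert.1 hv with rfl | hv'
      · exact (huv rfl).elim
      · exact g.adj_iff.2 (hcon v hv')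
      · exact (g.adj_iff.2 (hcon u hu')).symm
      · exact g.clique u hu' v hv' huv
  have hpx : p ≠ x := by rintro rfl; exact E.notMem hp
  have hKN : (N ∩ K).card ≤ k := by
    have : N ∩ K ⊆ K.erase p := by
      intro u; simp only [Finset.mem_inter, Finset.mem_erase]; grind
    have := Finset.card_le_card this
    rw [Finset.card_erase_of_mem hp, E.card_eq] at this
    exact this
  set C := N \ K with hC
  have hCc : N.card ≤ C.card + k := by
    have := Finset.card_sdiff_add_card_inter N K
    rw [hC]
    omega
  have hmem : ∀ c, c ∈ C ↔ c ∈ N ∧ c ∉ K := fun c => by simp [hC]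
  have hlow : ∀ v, v ∉ K → v ≠ x → (nbrs G₀ v).card ≤ (nbrs G₀ p).card := by
    intro v hvK hvx
    by_cases hvN : v ∈ N
    · exact (E.degree_eq g hvN hvK hp hpN).le
    · obtain ⟨c, hc⟩ := Finset.card_pos.1 (by omega : 0 < C.card)
      rw [hmem] at hc
      rw [← E.degree_eq g hc.1 hc.2 hp hpN]
      exact E.top c hc.1 v hvN hvx
  have hpk : k + 1 ≤ (nbrs G₀ p).card := by
    obtain ⟨v, hv, hv'⟩ : ∃ v, k + 1 ≤ (nbrs G₀ v).card ∧ v ∉ insert x (K.erase p) := by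
      by_contra! hcon
      have e1 := Finset.card_le_card (fun v hv => hcon v (Finset.mem_filter.1 hv).2 :
        (Finset.univ.filter fun v => k + 1 ≤ (nbrs G₀ v).card) ⊆ insert x (K.erase p))
      have e2 := Finset.card_insert_le x (K.erase p)
      rw [Finset.card_erase_of_mem hp, E.card_eq] at e2
      omega
    simp only [Finset.mem_insert, Finset.mem_erase, not_or, not_and] at hv'
    by_cases hvp : v = p
    · exact hvp ▸ hv
    · exact hv.trans (hlow v (hv'.2 hvp) hv'.1)
  obtain ⟨e, hpe, heK⟩ : ∃ e, G.Adj p e ∧ e ∉ K := by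
    by_contra! hcon
    have : nbrs G p ⊆ K.erase p := fun v hv => by
      rw [mem_nbrs] at hv
      exact Finset.mem_erase.2 ⟨hv.ne', hcon v hv⟩
    have := Finset.card_le_card this
    rw [Finset.card_erase_of_mem hp, E.card_eq, g.same] at this
    omega
  have hxp : ¬ G.Adj x p := fun h => hpN (g.adj_iff.1 h)
  have hex : e ≠ x := by rintro rfl; exact hxp hpe.symm
  obtain ⟨c, hcC, hce⟩ : ∃ c ∈ C, c = e → C.card ≤ 1 := by
    by_cases h1 : 1 < C.card
    · obtain ⟨c, hc, hce⟩ := Finset.exists_mem_ne h1 e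
      exact ⟨c, hc, fun h => (hce h).elim⟩
    · obtain ⟨c, hc⟩ := Finset.card_pos.1 (by omega : 0 < C.card)
      exact ⟨c, hc, fun _ => by omega⟩
  obtain ⟨hc, hcK⟩ := (hmem c).1 hcC
  have hxc := g.adj_iff.2 hc
  have hxC : x ∉ C := fun h => E.notMem_nbrs ((hmem x).1 h).1
  have hCk : C.card ≤ k := by
    by_contra! hcon
    refine hno (HasClique.of_le (K := insert x C) ?_ ?_)
    · rw [Finset.card_insert_of_notMem hxC]; omega
    · intro u hu v hv huv
      rcases Finset.mem_insert.1 hu with rfl | hu' <;>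
        rcases Finset.mem_insert.1 hv with rfl | hv'
      · exact (huv rfl).elim
      · exact g.adj_iff.2 ((hmem v).1 hv').1
      · exact (g.adj_iff.2 ((hmem u).1 hu').1).symm
      · rw [hmem] at hu' hv'
        exact E.adj_of_mem g hu'.1 hu'.2 hp hpN hpe heK hv'.1 hv'.2 huv
  have hdc : (nbrs G c).card = (nbrs G₀ p).card := by
    rw [g.same, E.degree_eq g hc hcK hp hpN]
  have hde : (nbrs G e).card ≤ (nbrs G₀ p).card := by
    rw [g.same]; exact hlow e heK hex
  have hdp := hmax p
  set Z := centre G x K c e with hZ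
  have hZc : Z.card ≤ 4 * k + 1 := by
    set A := insert c (nbrs G c) with hA
    set B := insert e (nbrs G e) with hB
    have hAc : A.card = (nbrs G₀ p).card + 1 := by
      rw [hA, Finset.card_insert_of_notMem (by simp), hdc]
    have hBc : B.card ≤ (nbrs G₀ p).card + 1 := by
      rw [hB, Finset.card_insert_of_notMem (by simp)]; omega
    have hAB : (A ∪ B).card ≤ (nbrs G₀ p).card + k + 1 := by
      have hU := Finset.card_union_add_card_inter A B
      by_cases hce' : c = e
      · have : A = B := by rw [hA, hB, hce']
        rw [this, Finset.union_self]
        omega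
      · have hAC : C ⊆ A := by
          intro y hy
          rw [hmem] at hy
          by_cases hyc : y = c
          · simp [hA, hyc]
          · simp [hA, E.adj_of_mem g hc hcK hp hpN hpe heK hy.1 hy.2 (Ne.symm hyc)]
        have hBC : C ⊆ B := by
          intro y hy
          rw [hmem] at hy
          by_cases hye : y = e
          · simp [hB, hye]
          · simp [hB, (E.adj_of_adj g hy.1 hy.2 hp hpN hpe heK (Ne.symm hye)).symm]
        have hCAB : C.card + 1 ≤ (A ∩ B).card := by
          by_cases heC : e ∈ C
          · rw [← Finset.card_insert_of_notMem hxC]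
            refine Finset.card_le_card (Finset.insert_subset ?_ (Finset.subset_inter hAC hBC))
            simp [hA, hB, hxc.symm, (g.adj_iff.2 ((hmem e).1 heC).1).symm]
          · rw [← Finset.card_insert_of_notMem heC]
            refine Finset.card_le_card (Finset.insert_subset ?_ (Finset.subset_inter hAC hBC))
            simp [hA, hB, E.adj_of_adj g hc hcK hp hpN hpe heK (Ne.symm hce')]
        omega
    have hS := Finset.card_union_add_card_inter (insert x K) (A ∪ B)
    have hSc : (insert x K).card = k + 2 := by
      rw [Finset.card_insert_of_notMem E.notMem, E.card_eq]
    have h2 : 2 ≤ (insert x K ∩ (A ∪ B)).card := by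
      rw [← Finset.card_pair hpx]
      refine Finset.card_le_card (Finset.insert_subset ?_ (Finset.singleton_subset_iff.2 ?_))
      · simp [hB, hp, hpe.symm]
      · simp [hA, hxc.symm]
    have : Z = insert x K ∪ (A ∪ B) := rfl
    rw [this]
    omega
  set Z₀ := Finset.univ.filter fun h => ∃ v, v ∉ Z ∧ G.Adj v h with hZ₀
  have hZ₀m : ∀ h, h ∈ Z₀ ↔ ∃ v, v ∉ Z ∧ G.Adj v h := fun h => by simp [hZ₀]
  have hZ₀e : ∀ h ∈ Z₀, G.Adj e h := by
    intro h hh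
    obtain ⟨v, hv, hvh⟩ := (hZ₀m h).1 hh
    exact (E.outer g hc hcK hp hpN hpe heK hv).2.2 h hvh
  have hZ₀k : Z₀.card ≤ k := by
    by_cases hpk' : (nbrs G₀ p).card ≤ k + 1
    · have : Z₀ ⊆ (nbrs G e).erase p := by
        intro h hh
        refine Finset.mem_erase.2 ⟨?_, by simpa using hZ₀e h hh⟩
        rintro rfl
        obtain ⟨v, hv, hvh⟩ := (hZ₀m h).1 hh
        exact (E.outer g hc hcK hp hpN hpe heK hv).2.1 hvh.symm
      have := Finset.card_le_card this
      rw [Finset.card_erase_of_mem (by simpa using hpe.symm)] at this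
      omega
    · have hce' : c ≠ e := fun h => by have := hce h; omega
      by_contra! hcon
      refine hno (HasClique.of_le (K := insert e Z₀) ?_ ?_)
      · rw [Finset.card_insert_of_notMem fun h => G.irrefl (hZ₀e e h)]; omega
      · intro u hu v hv huv
        rcases Finset.mem_insert.1 hu with rfl | hu' <;>
        rcases Finset.mem_insert.1 hv with rfl | hv'
        · exact (huv rfl).elim
        · exact hZ₀e v hv'
        · exact (hZ₀e u hu').symm
        · obtain ⟨a, ha, hau⟩ := (hZ₀m u).1 hu'
          obtain ⟨b, hb, hbv⟩ := (hZ₀m v).1 hv'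
          by_cases hab : a = b
          · subst hab
            by_cases hvK : v ∈ K
            · by_cases huK : u ∈ K
              · exact g.clique u huK v hvK huv
              · exact (E.adj_of_outer g hc hcK hp hpN hpe heK hce' ha hbv hau huv.symm huK).symm
            · exact E.adj_of_outer g hc hcK hp hpN hpe heK hce' ha hau hbv huv hvK
          · exact E.adj_of_outer_ne g hc hcK hp hpN hpe heK ha hb hab hau hbv huv
  have hZ₀Z : Z₀ ⊆ Z := by
    intro h hh
    by_contra hcon
    exact (notMem_centre.1 hcon).2.2.2 (hZ₀e h hh)
  have hkZ : k ≤ Z.card := by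
    have h1 : K ⊆ Z := fun u hu => by simp [hZ, centre, hu]
    have := Finset.card_le_card h1
    rw [E.card_eq] at this
    omega
  obtain ⟨D, hD1, hD2, hD3⟩ := Finset.exists_subsuperset_card_eq hZ₀Z hZ₀k hkZ
  exact hT.avoids_of_indep G hn hD2 hD3 (by omega) fun v hv h hvh =>
    hD1 ((hZ₀m h).2 ⟨v, hv, hvh⟩)

end Core

/-- Either a clique on `k + 2` vertices or a copy of `T` in the complement can be realized. -/
theorem SimpleGraph.IsTree.clique_or_avoids {W : Type} [Fintype W] {T : SimpleGraph W}
    (hT : T.IsTree) (k : ℕ) (hk : 7 * k < Fintype.card W) {V : Type} [Fintype V]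
    (hn : Fintype.card V = Fintype.card W + k) (G : SimpleGraph V) :
    (∃ H : SimpleGraph V, SameDeg H G ∧ HasClique H (k + 2)) ∨
      ∃ H : SimpleGraph V, SameDeg H G ∧ Avoids H T := by
  induction k generalizing V with
  | zero =>
    by_cases h : ∃ u v, G.Adj u v
    · obtain ⟨u, v, h⟩ := h
      refine Or.inl ⟨G, fun _ => rfl, {u, v}, Finset.card_pair h.ne, ?_⟩
      have := h.symm
      simp only [Finset.mem_insert, Finset.mem_singleton]
      grind
    · push Not at h
      exact Or.inr ⟨G, fun _ => rfl, Fintype.equivOfCardEq hn.symm, Equiv.injective _,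
        fun a b _ => h _ _⟩
  | succ k ih =>
    by_contra! hcon
    obtain ⟨hno, hav⟩ := hcon
    set Hi := Finset.univ.filter fun v => k + 1 + 1 ≤ (nbrs G v).card with hHi
    have c1 : (leaves T).card < Hi.card := by
      by_contra! h
      exact hav G (fun _ => rfl) (hT.avoids_of_few_high (by omega) G hn h)
    have c2 : k + 1 + 2 ≤ Hi.card := by
      by_contra! h
      exact hav G (fun _ => rfl) (hT.avoids_of_few_leaves (by omega) G (by omega) hn (by omega)
        (show Hi.card ≤ _ by omega))
    have hV : Nonempty V := Fintype.card_pos_iff.1 (by omega)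
    obtain ⟨x, -, hx⟩ := Finset.exists_max_image Finset.univ (fun v => (nbrs G v).card)
      Finset.univ_nonempty
    replace hx : ∀ v, (nbrs G v).card ≤ (nbrs G x).card := fun v => hx v (Finset.mem_univ v)
    have hxk : k + 1 + 1 ≤ (nbrs G x).card := by
      obtain ⟨v, hv⟩ := Finset.card_pos.1 (by omega : 0 < Hi.card)
      exact (Finset.mem_filter.1 hv).2.trans (hx v)
    obtain ⟨G₁, hG₁, htop⟩ := exists_nbrs_top G x
    have hcard : Fintype.card {v // v ≠ x} = Fintype.card W + k := by
      rw [Fintype.card_subtype_compl, Fintype.card_subtype_eq]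
      omega
    rcases ih (by omega) hcard (G₁.comap Subtype.val) with ⟨H, hH, L, hLc, hL⟩ | ⟨H, hH, φ, hφ, hφ'⟩
    · obtain ⟨G₂, hG₂, hN, hadj⟩ := exists_lift G₁ x H hH
      obtain ⟨⟨N, K⟩, ⟨m1, m2, m3, G', g'⟩, hmax⟩ := Set.exists_max_image
        {q : Finset V × Finset V | x ∉ q.2 ∧ q.2.card = k + 1 + 1 ∧ TopSet G x q.1 ∧
          ∃ G', Good G x q.1 q.2 G'} (fun q => (q.2 ∩ q.1).card) (Set.toFinite _)
        ⟨(nbrs G₁ x, L.map (Function.Embedding.subtype _)), by simp, by simpa using hLc,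
          htop, G₂, hG₂.trans hG₁, hN, by
            intro u hu v hv huv
            obtain ⟨u, hu', rfl⟩ := Finset.mem_map.1 hu
            obtain ⟨v, hv', rfl⟩ := Finset.mem_map.1 hv
            exact (hadj u v).2 (hL u hu' v hv' fun h => huv (by rw [h]))⟩
      dsimp only at m1 m2 m3 g'
      have hNc : N.card = (nbrs G x).card := by
        rw [← g'.nbrs_eq]; exact g'.same x
      refine hav G' g'.same (Extremal.avoids hT hk hn ⟨?_, m1, m2, m3, ?_⟩ g' (by omega)
        (fun v => hNc ▸ hx v) c2 (hno G' g'.same))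
      · rw [← g'.nbrs_eq]; simp
      · exact fun N' K' h1 h2 h3 h4 => hmax (N', K') ⟨h1, h2, h3, h4⟩
    · obtain ⟨G₂, hG₂, hN, hadj⟩ := exists_lift G₁ x H hH
      exact hav G₂ (hG₂.trans hG₁) ⟨fun w => φ w, Subtype.val_injective.comp hφ,
        fun a b hab h => hφ' a b hab ((hadj _ _).1 h)⟩

section Sequences

lemma deg_eq_card_nbrs {V : Type} [Fintype V] (G : SimpleGraph V) (v : V) :
    deg G v = (nbrs G v).card := by
  rw [deg, Nat.card_eq_fintype_card, ← Set.toFinset_card]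
  congr 1
  ext
  simp

variable {n : ℕ} {G : SimpleGraph (Fin n)} {π : Fin n → ℕ}

lemma IsRealization.of_sameDeg {H : SimpleGraph (Fin n)} (hG : IsRealization G π)
    (h : SameDeg H G) : IsRealization H π := fun i => by
  rw [deg_eq_card_nbrs, h, ← deg_eq_card_nbrs, hG]

lemma IsRealization.le (hG : IsRealization G π) (i : Fin n) : π i ≤ n - 1 := by
  have h : nbrs G i ⊆ Finset.univ.erase i := fun u hu => by
    simpa using (mem_nbrs.1 hu).ne'
  have := Finset.card_le_card h
  rw [Finset.card_erase_of_mem (Finset.mem_univ i), Finset.card_univ, Fintype.card_fin,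
    ← deg_eq_card_nbrs, hG] at this
  exact this

lemma IsRealization.compSeq (hG : IsRealization G π) :
    IsRealization (Gᶜ.comap Fin.rev) (compSeq π) := fun i => by
  have h : nbrs (Gᶜ.comap Fin.rev) i =
      (((nbrs G i.rev)ᶜ).erase i.rev).map Fin.revPerm.toEmbedding := by
    ext u
    rw [Finset.mem_map_equiv]
    simp [eq_comm]
  rw [deg_eq_card_nbrs, h, Finset.card_map, Finset.card_erase_of_mem (by simp),
    Finset.card_compl, Fintype.card_fin, ← deg_eq_card_nbrs, hG, _root_.compSeq]
  omega

lemma Graphic.compSeq (hπ : Graphic π) : Graphic (compSeq π) :=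
  hπ.imp' (fun G => Gᶜ.comap Fin.rev) fun _ h => h.compSeq

lemma Graphic.compSeq_compSeq (hπ : Graphic π) : _root_.compSeq (_root_.compSeq π) = π := by
  obtain ⟨G, hG⟩ := hπ
  funext i
  have := hG.le i
  simp only [_root_.compSeq, Fin.rev_rev]
  omega

theorem Graphic.tree_or_clique {s : ℕ} {W : Type} [Fintype W] {T : SimpleGraph W}
    (hT : T.IsTree) (hs : 2 ≤ s) (ht : 7 * (s - 2) < Fintype.card W)
    (hn : n = Fintype.card W + s - 2) (hπ : Graphic π) :
    PotentiallyGraphic π T ∨ PotentiallyGraphic (_root_.compSeq π) (⊤ : SimpleGraph (Fin s)) := by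
  obtain ⟨G, hG⟩ := hπ.compSeq
  rcases hT.clique_or_avoids (s - 2) ht (by rw [Fintype.card_fin]; omega) G with
    ⟨H, hH, K, hK, hKc⟩ | ⟨H, hH, φ, hφ, hφ'⟩
  · refine Or.inr ⟨H, hG.of_sameDeg hH,
      (K.orderEmbOfFin (k := s) (by omega)).toEmbedding, fun a b hab => ?_⟩
    exact hKc _ (Finset.orderEmbOfFin_mem _ _ _) _ (Finset.orderEmbOfFin_mem _ _ _)
      (by simpa using hab)
  · refine Or.inl ⟨Hᶜ.comap Fin.rev, ?_, ⟨fun w => (φ w).rev, Fin.rev_injective.comp hφ⟩,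
      fun a b hab => ?_⟩
    · rw [← hπ.compSeq_compSeq]
      exact (hG.of_sameDeg hH).compSeq
    · simpa [hφ.eq_iff, hab.ne] using hφ' a b hab

/-- The sequence with `j` dominating entries and all others equal to `j`. -/
def splitSeq (n j : ℕ) : Fin n → ℕ := fun i => if (i : ℕ) < j then n - 1 else j

lemma card_fin_lt {n j : ℕ} (h : j ≤ n) :
    (Finset.univ.filter fun i : Fin n => (i : ℕ) < j).card = j := by
  simp [Fin.card_filter_val_lt, h]

lemma antitone_splitSeq (n j : ℕ) : Antitone (splitSeq n j) := by
  intro a b hab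
  have : (a : ℕ) ≤ b := hab
  have := b.2
  simp only [splitSeq]
  split_ifs <;> omega

lemma graphic_splitSeq {n j : ℕ} (h : j ≤ n) : Graphic (splitSeq n j) := by
  refine ⟨SimpleGraph.fromRel fun u _ => (u : ℕ) < j, fun i => ?_⟩
  rw [deg_eq_card_nbrs, splitSeq]
  split_ifs with hi
  · have : nbrs (SimpleGraph.fromRel fun (u _ : Fin n) => (u : ℕ) < j) i =
        Finset.univ.erase i := by
      ext u; simp [hi, eq_comm]
    rw [this, Finset.card_erase_of_mem (Finset.mem_univ i), Finset.card_univ, Fintype.card_fin]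
  · have : nbrs (SimpleGraph.fromRel fun (u _ : Fin n) => (u : ℕ) < j) i =
        Finset.univ.filter fun u : Fin n => (u : ℕ) < j := by
      ext u; simp only [mem_nbrs, fromRel_adj, Finset.mem_filter, Finset.mem_univ, true_and]
      grind
    rw [this, card_fin_lt h]

lemma IsRealization.splitSeq_adj {j : ℕ} (h : j ≤ n) (hG : IsRealization G (splitSeq n j))
    {u v : Fin n} (huv : G.Adj u v) : (u : ℕ) < j ∨ (v : ℕ) < j := by
  have hdom : ∀ a b : Fin n, (a : ℕ) < j → b ≠ a → G.Adj a b := by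
    intro a b ha hb
    have h1 : nbrs G a ⊆ Finset.univ.erase a := fun u hu => by
      simpa using (mem_nbrs.1 hu).ne'
    have h2 := Finset.eq_of_subset_of_card_le h1 (by
      rw [← deg_eq_card_nbrs, hG, splitSeq, if_pos ha,
        Finset.card_erase_of_mem (Finset.mem_univ a), Finset.card_univ, Fintype.card_fin])
    rw [← mem_nbrs, h2]
    simpa using hb
  by_contra! hcon
  have h1 : (Finset.univ.filter fun i : Fin n => (i : ℕ) < j) ⊆ nbrs G u := by
    intro a ha
    simp only [Finset.mem_filter, Finset.mem_univ, true_and] at ha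
    rw [mem_nbrs]
    exact (hdom a u ha (by rintro rfl; omega)).symm
  have h2 := Finset.eq_of_subset_of_card_le h1 (by
    rw [← deg_eq_card_nbrs, hG, splitSeq, if_neg (by omega), card_fin_lt h])
  rw [← mem_nbrs, ← h2] at huv
  simp only [Finset.mem_filter, Finset.mem_univ, true_and] at huv
  omega

lemma not_potentiallyGraphic_splitSeq_top {n j s : ℕ} (h : j ≤ n) (hs : j + 2 ≤ s) :
    ¬ PotentiallyGraphic (splitSeq n j) (⊤ : SimpleGraph (Fin s)) := by
  rintro ⟨G, hG, f, hf⟩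
  set A := Finset.univ.filter fun a : Fin s => (f a : ℕ) < j with hA
  have h1 : A.card ≤ j := by
    rw [← card_fin_lt h]
    exact Finset.card_le_card_of_injOn f (fun a ha => by simpa [hA] using ha) f.injective.injOn
  have h2 : Aᶜ.card ≤ 1 := by
    refine Finset.card_le_one.2 fun a ha b hb => ?_
    by_contra hab
    simp only [hA, Finset.mem_compl, Finset.mem_filter, Finset.mem_univ, true_and] at ha hb
    exact (hG.splitSeq_adj h (hf a b hab)).elim ha hb
  have h3 := Finset.card_add_card_compl A
  rw [Fintype.card_fin] at h3
  omega

lemma SimpleGraph.IsTree.not_potentiallyGraphic_compSeq_splitSeq {j : ℕ} {W : Type} [Fintype W]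
    {T : SimpleGraph W} (hT : T.IsTree) (hW : 2 ≤ Fintype.card W) (h : j ≤ n)
    (hn : n < j + Fintype.card W) : ¬ PotentiallyGraphic (compSeq (splitSeq n j)) T := by
  rintro ⟨G, hG, f, hf⟩
  have hmem : ∀ w, ¬ ((f w).rev : ℕ) < j := by
    intro w hw
    obtain ⟨u, hu⟩ := Finset.card_pos.1 (hT.nbrs_nonempty hW w)
    have h1 : f u ∈ nbrs G (f w) := mem_nbrs.2 (hf w u (mem_nbrs.1 hu))
    have h2 := Finset.card_pos.2 ⟨_, h1⟩
    rw [← deg_eq_card_nbrs, hG, compSeq, splitSeq, if_pos hw] at h2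
    omega
  have h1 : (Finset.univ : Finset W).card ≤
      (Finset.univ.filter fun i : Fin n => (i : ℕ) < j)ᶜ.card :=
    Finset.card_le_card_of_injOn (fun w => (f w).rev)
      (fun w _ => by
        have := hmem w
        simp only [Finset.coe_compl, Set.mem_compl_iff, Finset.mem_coe, Finset.mem_filter,
          Finset.mem_univ, true_and]
        exact this)
      (Fin.rev_injective.comp f.injective).injOn
  rw [Finset.card_compl, card_fin_lt h, Fintype.card_fin, Finset.card_univ] at h1
  omega

end Sequences

/-- Main theorem: for a tree T of order t and s ≥ 2 with t > 7(s-2), every graphic sequence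
of length t+s-2 is potentially T-graphic or its complement is potentially K_s-graphic;
hence r_pot(K_s, T) = t + s - 2. -/
theorem tree_clique_main {t s : ℕ} {W : Type} [Fintype W] (T : SimpleGraph W)
    (hT : T.IsTree) (hcard : Fintype.card W = t) (hs : 2 ≤ s) (ht : 7 * (s - 2) < t) :
    (∀ π : Fin (t + s - 2) → ℕ, Antitone π → Graphic π →
        PotentiallyGraphic π T ∨
          PotentiallyGraphic (compSeq π) (⊤ : SimpleGraph (Fin s))) ∧
    rpot (⊤ : SimpleGraph (Fin s)) T = t + s - 2 := by
  subst hcard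
  refine ⟨fun π _ hπ => hπ.tree_or_clique hT hs ht rfl, ?_⟩
  have hmem : Fintype.card W + s - 2 ∈ {N : ℕ | ∀ π : Fin N → ℕ, Antitone π → Graphic π →
      PotentiallyGraphic π (⊤ : SimpleGraph (Fin s)) ∨ PotentiallyGraphic (compSeq π) T} := by
    intro π _ hπ
    have := hπ.compSeq.tree_or_clique hT hs ht rfl
    rw [hπ.compSeq_compSeq] at this
    exact this.symm
  refine le_antisymm (Nat.sInf_le hmem) (le_csInf ⟨_, hmem⟩ fun N hN => ?_)
  by_contra! hlt
  rcases hN (splitSeq N (N - (Fintype.card W - 1))) (antitone_splitSeq _ _)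
    (graphic_splitSeq (Nat.sub_le _ _)) with h | h
  · exact not_potentiallyGraphic_splitSeq_top (Nat.sub_le _ _) (by omega) h
  · by_cases hW : 2 ≤ Fintype.card W
    · exact hT.not_potentiallyGraphic_compSeq_splitSeq hW (Nat.sub_le _ _) (by omega) h
    · obtain ⟨G, -, f, -⟩ := h
      obtain ⟨w⟩ := hT.connected.nonempty
      have := (f w).2
      omega
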